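/- arXiv:1206.0835 — 2 statements merged into one kernel-verified Lean document; each statement's English description precedes it below -/
import Mathlib

section
/- For every finitely supported radial function $f$ on $\mathbb{T}$ the Plancherel formula holds: $\|f\|_{L^2(\mathbb{T})}^2 = \dfrac{Q^{1/2}}{Q^{1/2}+Q^{-1/2}}\cdot\dfrac{1}{\tau}\displaystyle\int_0^{\tau/2}\frac{|\mathcal{H}f(\lambda)|^2}{|\mathbf{c}(\lambda)|^2}\,d\lambda$, where $\|f\|_{L^2(\mathbb{T})}^2=|f(0)|^2+\sum_{n\ge1}(Q+1)Q^{n-1}|f(n)|^2$. -/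
noncomputable section

open Complex MeasureTheory Filter
open scoped ENNReal NNReal Topology

/-- `τ = 2π / log Q`. -/
def tauQ (Q : ℕ) : ℝ := 2 * Real.pi / Real.log Q

/-- The meromorphic function `𝐜(z)`. -/
def cFun (Q : ℕ) (z : ℂ) : ℂ :=
  (1 / ((Real.sqrt Q : ℂ) + (Real.sqrt Q : ℂ)⁻¹)) *
    (((Q : ℂ) ^ ((1 / 2 : ℂ) + Complex.I * z) -
        (Q : ℂ) ^ (-(1 / 2 : ℂ) - Complex.I * z)) /
      ((Q : ℂ) ^ (Complex.I * z) - (Q : ℂ) ^ (-(Complex.I * z))))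

/-- The spherical function `φ_λ(n) = 𝐜(λ) Q^{(-1/2+iλ)n} + 𝐜(-λ) Q^{(-1/2-iλ)n}`. -/
def sphFn (Q : ℕ) (lam : ℂ) (n : ℕ) : ℂ :=
  cFun Q lam * (Q : ℂ) ^ ((-(1 / 2 : ℂ) + Complex.I * lam) * (n : ℂ)) +
    cFun Q (-lam) * (Q : ℂ) ^ ((-(1 / 2 : ℂ) - Complex.I * lam) * (n : ℂ))

/-- The spherical Fourier transform of a radial function `f` on the tree,
`ℋf(λ) = f(0) + ∑_{n≥1} (Q+1) Q^{n-1} f(n) φ_λ(n)`. -/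
def sphTransform (Q : ℕ) (f : ℕ → ℂ) (lam : ℂ) : ℂ :=
  f 0 + ∑' n : ℕ, ((Q : ℂ) + 1) * (Q : ℂ) ^ n * f (n + 1) * sphFn Q lam (n + 1)

open Polynomial in
/-- Mean over the unit circle of the density arising in the Plancherel formula: Parseval handles
the first summand, the mean value property the second. -/
theorem circleAverage_normSq_add_re_cross (p : ℂ[X]) {q : ℝ} (hq : 1 < q) :
    CircleIntegrable (fun u : ℂ => ‖p.eval u‖ ^ 2 + ((p.map (starRingEnd ℂ)).eval u * p.eval u *
      (((q : ℂ)⁻¹ - u ^ 2) / (1 - u ^ 2 / q))).re) 0 1 ∧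
    Real.circleAverage (fun u : ℂ => ‖p.eval u‖ ^ 2 + ((p.map (starRingEnd ℂ)).eval u * p.eval u *
      (((q : ℂ)⁻¹ - u ^ 2) / (1 - u ^ 2 / q))).re) 0 1 =
      ∑ i ∈ p.support, ‖p.coeff i‖ ^ 2 + q⁻¹ * ‖p.coeff 0‖ ^ 2 := by
  have hden : ∀ u ∈ Metric.closedBall (0 : ℂ) 1, (1 : ℂ) - u ^ 2 / q ≠ 0 := by
    intro u hu h
    have hu1 : ‖u‖ ≤ 1 := by simpa using hu
    have h1 : u ^ 2 = q := by
      have hq0 : (q : ℂ) ≠ 0 := by exact_mod_cast (by linarith : q ≠ 0)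
      field_simp at h
      linear_combination -h
    have h2 : ‖u‖ ^ 2 = q := by
      rw [← norm_pow, h1, Complex.norm_real, Real.norm_of_nonneg (by linarith)]
    nlinarith [norm_nonneg u]
  set E : ℂ → ℂ := fun u => (p.map (starRingEnd ℂ)).eval u * p.eval u *
      (((q : ℂ)⁻¹ - u ^ 2) / (1 - u ^ 2 / q)) with hE
  have hdiff : DifferentiableOn ℂ E (Metric.closedBall 0 1) := by
    apply DifferentiableOn.mul
    · exact ((Polynomial.differentiable _).mul (Polynomial.differentiable _)).differentiableOn
    · exact DifferentiableOn.div (by fun_prop) (by fun_prop) hden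
  have hEint : CircleIntegrable E 0 1 :=
    (hdiff.continuousOn.mono Metric.sphere_subset_closedBall).circleIntegrable zero_le_one
  have hEavg : Real.circleAverage E 0 1 = E 0 :=
    DiffContOnCl.circleAverage (by simpa using (hdiff.diffContOnCl_ball subset_rfl))
  have hre : Real.circleAverage (fun u => (E u).re) 0 1 = (E 0).re := by
    rw [← hEavg]
    exact Complex.reCLM.circleAverage_comp_comm hEint
  have hreint : CircleIntegrable (fun u => (E u).re) 0 1 :=
    ((Complex.continuous_re.comp_continuousOn hdiff.continuousOn).mono
      Metric.sphere_subset_closedBall).circleIntegrable zero_le_one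
  have hPint : CircleIntegrable (fun u => ‖p.eval u‖ ^ 2) 0 1 :=
    (by fun_prop : Continuous fun u => ‖p.eval u‖ ^ 2).continuousOn.circleIntegrable zero_le_one
  refine ⟨hPint.add hreint, ?_⟩
  rw [Real.circleAverage_fun_add hPint hreint, hre, ← sum_sq_norm_coeff_eq_circleAverage]
  congr 1
  simp only [hE, ← Polynomial.coeff_zero_eq_eval_zero, Polynomial.coeff_map]
  rw [← Complex.normSq_eq_conj_mul_self, Complex.normSq_eq_norm_sq, ← Complex.ofReal_inv]
  norm_cast
  simp [mul_comm]

/-- Folding the circle onto its upper half. -/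
theorem integral_exp_add_exp_neg_eq_circleAverage {g : ℂ → ℝ} (hg : CircleIntegrable g 0 1) :
    ∫ t in (0 : ℝ)..Real.pi, (g (cexp (I * t)) + g (cexp (-(I * t)))) =
      2 * Real.pi * Real.circleAverage g 0 1 := by
  have hmap : ∀ t : ℝ, circleMap 0 1 t = cexp (I * t) := fun t => by simp [circleMap, mul_comm]
  have hint : IntervalIntegrable (fun t : ℝ => g (cexp (I * t))) volume 0 (2 * Real.pi) := by
    simpa only [CircleIntegrable, hmap] using hg
  have hpi := Real.pi_pos
  have h1 : IntervalIntegrable (fun t : ℝ => g (cexp (I * t))) volume 0 Real.pi :=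
    hint.mono_set (by
      rw [Set.uIcc_of_le hpi.le, Set.uIcc_of_le (by linarith)]
      exact Set.Icc_subset_Icc le_rfl (by linarith))
  have h2 : IntervalIntegrable (fun t : ℝ => g (cexp (I * t))) volume Real.pi (2 * Real.pi) :=
    hint.mono_set (by
      rw [Set.uIcc_of_le (by linarith), Set.uIcc_of_le (by linarith)]
      exact Set.Icc_subset_Icc hpi.le le_rfl)
  have hrefl : ∀ t : ℝ, g (cexp (-(I * t))) = g (cexp (I * ((2 * Real.pi - t : ℝ) : ℂ))) := by
    intro t
    congr 1
    rw [← Complex.exp_periodic (-(I * t))]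
    congr 1
    push_cast
    ring
  have h3 : IntervalIntegrable (fun t : ℝ => g (cexp (-(I * t)))) volume 0 Real.pi := by
    simp only [hrefl]
    have := (h2.comp_sub_left (2 * Real.pi)).symm
    simpa [two_mul] using this
  rw [intervalIntegral.integral_add h1 h3]
  have h4 : ∫ t in (0 : ℝ)..Real.pi, g (cexp (-(I * t))) =
      ∫ t in Real.pi..(2 * Real.pi), g (cexp (I * t)) := by
    simp only [hrefl]
    rw [intervalIntegral.integral_comp_sub_left (fun t : ℝ => g (cexp (I * t)))]
    congr 1 <;> ring
  rw [h4, intervalIntegral.integral_add_adjacent_intervals h1 h2, Real.circleAverage_def]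
  simp only [hmap, smul_eq_mul]
  field_simp

open Polynomial in
/-- Pointwise expansion of `|c F(z) + c' F(z⁻¹)|² / |c|²` on the unit circle. -/
theorem normSq_add_div_normSq_eq (p : ℂ[X]) {s : ℝ} (hs : 1 < s) {z w : ℂ} (hw : w = starRingEnd ℂ z)
    (hzw : z * w = 1) (hne : z ≠ w) {k : ℂ} (hk : k ≠ 0) :
    ‖k * ((s * z - (s : ℂ)⁻¹ * w) / (z - w)) * p.eval z +
        k * ((s * w - (s : ℂ)⁻¹ * z) / (w - z)) * p.eval w‖ ^ 2 /
      ‖k * ((s * z - (s : ℂ)⁻¹ * w) / (z - w))‖ ^ 2 =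
    (‖p.eval z‖ ^ 2 + ((p.map (starRingEnd ℂ)).eval z * p.eval z *
      ((((s ^ 2 : ℝ) : ℂ)⁻¹ - z ^ 2) / (1 - z ^ 2 / (s ^ 2 : ℝ)))).re) +
    (‖p.eval w‖ ^ 2 + ((p.map (starRingEnd ℂ)).eval w * p.eval w *
      ((((s ^ 2 : ℝ) : ℂ)⁻¹ - w ^ 2) / (1 - w ^ 2 / (s ^ 2 : ℝ)))).re) := by
  have hs0 : (s : ℂ) ≠ 0 := by exact_mod_cast (by linarith : s ≠ 0)
  have hz : starRingEnd ℂ w = z := by simp [hw]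
  have hz1 : ‖z‖ = 1 := by
    have h := congrArg norm hzw
    rw [hw, norm_mul, Complex.norm_conj, norm_one] at h
    nlinarith [norm_nonneg z]
  have hw1 : ‖w‖ = 1 := by rw [hw, Complex.norm_conj, hz1]
  have hz0 : z ≠ 0 := left_ne_zero_of_mul_eq_one hzw
  have hw0 : w ≠ 0 := right_ne_zero_of_mul_eq_one hzw
  have hden : (s : ℂ) * z - (s : ℂ)⁻¹ * w ≠ 0 := by
    intro h
    have h1 : (s : ℂ) ^ 2 * z = w := by
      field_simp at h
      linear_combination h
    have h2 := congrArg norm h1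
    rw [norm_mul, norm_pow, hz1, hw1, Complex.norm_real, Real.norm_of_nonneg (by linarith)] at h2
    nlinarith
  have hsub : z - w ≠ 0 := sub_ne_zero.mpr hne
  have hsub' : w - z ≠ 0 := sub_ne_zero.mpr hne.symm
  set c : ℂ := k * ((s * z - (s : ℂ)⁻¹ * w) / (z - w)) with hc
  have hc0 : c ≠ 0 := mul_ne_zero hk (div_ne_zero hden hsub)
  set B : ℂ := (((s ^ 2 : ℝ) : ℂ)⁻¹ - w ^ 2) / (1 - w ^ 2 / (s ^ 2 : ℝ)) with hB
  have hden2 : (1 : ℂ) - w ^ 2 / (s ^ 2 : ℝ) = (s : ℂ)⁻¹ * w * (s * z - (s : ℂ)⁻¹ * w) := by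
    push_cast
    field_simp
    linear_combination -(s : ℂ) ^ 2 * hzw
  have hB' : B = ((s : ℂ)⁻¹ * z - s * w) / (s * z - (s : ℂ)⁻¹ * w) := by
    rw [hB, hden2, div_eq_div_iff (mul_ne_zero (mul_ne_zero (inv_ne_zero hs0) hw0) hden) hden]
    push_cast
    linear_combination (s * z - (s : ℂ)⁻¹ * w) *
      (w ^ 2 * mul_inv_cancel₀ hs0 - ((s : ℂ)⁻¹) ^ 2 * hzw)
  have hBnorm : ‖B‖ = 1 := by
    have h : starRingEnd ℂ ((s : ℂ)⁻¹ * z - s * w) = -(s * z - (s : ℂ)⁻¹ * w) := by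
      simp [← hw, hz]
    rw [hB', norm_div, ← Complex.norm_conj, h, norm_neg, div_self (norm_ne_zero_iff.mpr hden)]
  have hc' : k * ((s * w - (s : ℂ)⁻¹ * z) / (w - z)) = c * B := by
    rw [hB', hc, mul_assoc, div_mul_div_cancel₀' hden, ← neg_sub z w, div_neg, ← neg_div, neg_sub]
  have hconjp : ∀ x, starRingEnd ℂ (p.eval x) = (p.map (starRingEnd ℂ)).eval (starRingEnd ℂ x) :=
    fun x => by rw [Polynomial.eval_map, Polynomial.eval₂_at_apply]
  have hconjB : starRingEnd ℂ B = (((s ^ 2 : ℝ) : ℂ)⁻¹ - z ^ 2) / (1 - z ^ 2 / (s ^ 2 : ℝ)) := by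
    simp [hB, hz]
  rw [hc', ← hconjB, mul_assoc c B, ← mul_add, norm_mul, mul_pow,
    mul_div_cancel_left₀ _ (pow_ne_zero 2 (norm_ne_zero_iff.mpr hc0))]
  have hcross : (p.map (starRingEnd ℂ)).eval z * p.eval z * starRingEnd ℂ B =
      starRingEnd ℂ ((p.map (starRingEnd ℂ)).eval w * p.eval w * B) := by
    have h : starRingEnd ℂ ((p.map (starRingEnd ℂ)).eval w) = p.eval z := by
      rw [hw, ← hconjp, Complex.conj_conj]
    rw [map_mul, map_mul, h, hconjp w, hz]
    ring
  rw [hcross, Complex.conj_re]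
  rw [← Complex.normSq_eq_norm_sq, Complex.normSq_add, Complex.normSq_eq_norm_sq,
    Complex.normSq_eq_norm_sq, norm_mul, hBnorm, one_mul]
  have h5 : (p.eval z * starRingEnd ℂ (B * p.eval w)).re =
      ((p.map (starRingEnd ℂ)).eval w * p.eval w * B).re := by
    rw [← Complex.conj_re, map_mul, Complex.conj_conj, hconjp z, ← hw]
    ring_nf
  rw [h5]
  ring

section SphericalTransform

variable {Q : ℕ}

theorem natCast_cpow_half_eq_sqrt (Q : ℕ) : (Q : ℂ) ^ (1 / 2 : ℂ) = (Real.sqrt Q : ℂ) := by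
  rw [Real.sqrt_eq_rpow, Complex.ofReal_cpow (Nat.cast_nonneg Q)]
  norm_num

theorem cFun_eq (hQ : 2 ≤ Q) (lam : ℂ) :
    cFun Q lam = (1 / ((Real.sqrt Q : ℂ) + (Real.sqrt Q : ℂ)⁻¹)) *
      (((Real.sqrt Q : ℂ) * (Q : ℂ) ^ (I * lam) - (Real.sqrt Q : ℂ)⁻¹ * (Q : ℂ) ^ (-(I * lam))) /
        ((Q : ℂ) ^ (I * lam) - (Q : ℂ) ^ (-(I * lam)))) := by
  have hQ0 : (Q : ℂ) ≠ 0 := by exact_mod_cast (by lia : Q ≠ 0)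
  rw [cFun, sub_eq_add_neg (-(1 / 2 : ℂ)), Complex.cpow_add _ _ hQ0, Complex.cpow_add _ _ hQ0,
    Complex.cpow_neg _ (1 / 2), natCast_cpow_half_eq_sqrt]

theorem sphFn_eq (hQ : 2 ≤ Q) (lam : ℂ) (n : ℕ) :
    sphFn Q lam n = ((Real.sqrt Q : ℂ)⁻¹) ^ n *
      (cFun Q lam * ((Q : ℂ) ^ (I * lam)) ^ n + cFun Q (-lam) * ((Q : ℂ) ^ (-(I * lam))) ^ n) := by
  have hQ0 : (Q : ℂ) ≠ 0 := by exact_mod_cast (by lia : Q ≠ 0)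
  rw [sphFn, sub_eq_add_neg (-(1 / 2 : ℂ)), Complex.cpow_mul_nat, Complex.cpow_mul_nat,
    Complex.cpow_add _ _ hQ0, Complex.cpow_add _ _ hQ0, Complex.cpow_neg _ (1 / 2),
    natCast_cpow_half_eq_sqrt, mul_pow, mul_pow]
  ring

/-- Coefficients of the polynomial `F` for which `ℋf(λ) = 𝐜(λ) F(Q^{iλ}) + 𝐜(-λ) F(Q^{-iλ})`. -/
def sphCoeff (Q : ℕ) (f : ℕ → ℂ) : ℕ → ℂ
  | 0 => f 0
  | n + 1 => ((Q : ℂ) + 1) * (Q : ℂ) ^ n * f (n + 1) * ((Real.sqrt Q : ℂ)⁻¹) ^ (n + 1)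

/-- The polynomial `F` for which `ℋf(λ) = 𝐜(λ) F(Q^{iλ}) + 𝐜(-λ) F(Q^{-iλ})`, when `f` vanishes
beyond `N`. -/
def sphPoly (Q : ℕ) (f : ℕ → ℂ) (N : ℕ) : Polynomial ℂ :=
  ∑ n ∈ Finset.range (N + 1), Polynomial.monomial n (sphCoeff Q f n)

theorem coeff_sphPoly (Q : ℕ) (f : ℕ → ℂ) (N n : ℕ) :
    (sphPoly Q f N).coeff n = if n < N + 1 then sphCoeff Q f n else 0 := by
  simp [sphPoly, Polynomial.coeff_monomial]

theorem sphTransform_eq (hQ : 2 ≤ Q) {f : ℕ → ℂ} {N : ℕ} (hN : ∀ n, N < n → f n = 0) {lam : ℂ}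
    (hne : (Q : ℂ) ^ (I * lam) ≠ (Q : ℂ) ^ (-(I * lam))) :
    sphTransform Q f lam = cFun Q lam * (sphPoly Q f N).eval ((Q : ℂ) ^ (I * lam)) +
      cFun Q (-lam) * (sphPoly Q f N).eval ((Q : ℂ) ^ (-(I * lam))) := by
  have hsum : cFun Q lam + cFun Q (-lam) = 1 := by
    have hs : 0 < Real.sqrt Q := Real.sqrt_pos.mpr (by exact_mod_cast (by lia : 0 < Q))
    have hs0 : (Real.sqrt Q : ℂ) ≠ 0 := by exact_mod_cast hs.ne'
    have hK : (Real.sqrt Q : ℂ) + (Real.sqrt Q : ℂ)⁻¹ ≠ 0 := by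
      exact_mod_cast (by positivity : Real.sqrt Q + (Real.sqrt Q)⁻¹ ≠ 0)
    rw [cFun_eq hQ, cFun_eq hQ, mul_neg, neg_neg]
    have h1 := sub_ne_zero.mpr hne
    have h2 := sub_ne_zero.mpr hne.symm
    generalize (Q : ℂ) ^ (I * lam) = z at *
    generalize (Q : ℂ) ^ (-(I * lam)) = w at *
    rw [← neg_sub z w, div_neg, ← mul_add, ← sub_eq_add_neg, ← sub_div,
      div_mul_div_comm, one_mul, div_eq_one_iff_eq (mul_ne_zero hK h1)]
    ring
  rw [sphTransform, tsum_eq_sum (s := Finset.range N)]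
  · simp only [sphPoly, Polynomial.eval_finsetSum, Polynomial.eval_monomial]
    rw [Finset.sum_range_succ', Finset.sum_range_succ', mul_add, mul_add, Finset.mul_sum,
      Finset.mul_sum]
    simp only [sphFn_eq hQ, sphCoeff, pow_zero, mul_one]
    rw [add_add_add_comm, ← add_mul, hsum, one_mul, add_comm (f 0), ← Finset.sum_add_distrib]
    congr 1
    exact Finset.sum_congr rfl fun n _ => by ring
  · intro n hn
    rw [hN (n + 1) (by simpa using hn)]
    simp

end SphericalTransform

/-- Plancherel formula for the spherical Fourier transform on the homogeneous
tree: for every finitely supported radial `f`,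
`‖f‖²_{L²} = (Q^{1/2}/(Q^{1/2}+Q^{-1/2})) τ⁻¹ ∫₀^{τ/2} |ℋf(λ)|²/|𝐜(λ)|² dλ`. -/
theorem plancherel (Q : ℕ) (hQ : 2 ≤ Q) (f : ℕ → ℂ)
    (hf : (Function.support f).Finite) :
    ‖f 0‖ ^ 2 + ∑' n : ℕ, ((Q : ℝ) + 1) * (Q : ℝ) ^ n * ‖f (n + 1)‖ ^ 2 =
      (Real.sqrt Q / (Real.sqrt Q + (Real.sqrt Q)⁻¹)) * (1 / tauQ Q) *
        ∫ lam in (0 : ℝ)..(tauQ Q / 2),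
          ‖sphTransform Q f (lam : ℂ)‖ ^ 2 / ‖cFun Q (lam : ℂ)‖ ^ 2 := by
  obtain ⟨N, hN⟩ := hf.bddAbove
  have hN' : ∀ n, N < n → f n = 0 := fun n hn => by
    by_contra h
    exact absurd (hN h) (by simpa using hn)
  have hQ1 : (1 : ℝ) < Q := by exact_mod_cast (by lia : 1 < Q)
  have hlog : 0 < Real.log Q := Real.log_pos hQ1
  have hsq : Real.sqrt Q ^ 2 = Q := Real.sq_sqrt (by positivity)
  have hs1 : 1 < Real.sqrt Q := by
    rw [Real.lt_sqrt zero_le_one]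
    simpa using hQ1
  set s := Real.sqrt Q with hs
  set p := sphPoly Q f N with hp
  obtain ⟨hgint, hgavg⟩ := circleAverage_normSq_add_re_cross p hQ1
  set g : ℂ → ℝ := fun u => ‖p.eval u‖ ^ 2 + ((p.map (starRingEnd ℂ)).eval u * p.eval u *
      ((((Q : ℝ) : ℂ)⁻¹ - u ^ 2) / (1 - u ^ 2 / (Q : ℝ)))).re with hg
  have hpow : ∀ lam : ℂ, (Q : ℂ) ^ (I * lam) = cexp (I * (lam * Real.log Q)) := by
    intro lam
    rw [Complex.cpow_def_of_ne_zero (by exact_mod_cast (by lia : Q ≠ 0)), Complex.natCast_log]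
    ring_nf
  have hpow' : ∀ lam : ℂ, (Q : ℂ) ^ (-(I * lam)) = cexp (-(I * (lam * Real.log Q))) := by
    intro lam
    rw [Complex.cpow_neg, hpow, Complex.exp_neg]
  have hint : ∫ lam in (0 : ℝ)..(tauQ Q / 2),
      ‖sphTransform Q f (lam : ℂ)‖ ^ 2 / ‖cFun Q (lam : ℂ)‖ ^ 2 =
      (Real.log Q)⁻¹ * (2 * Real.pi * Real.circleAverage g 0 1) := by
    rw [← integral_exp_add_exp_neg_eq_circleAverage hgint]
    have hsub := intervalIntegral.integral_comp_mul_right (a := 0) (b := tauQ Q / 2)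
      (fun t : ℝ => g (cexp (I * t)) + g (cexp (-(I * t)))) hlog.ne'
    have htau : tauQ Q / 2 * Real.log Q = Real.pi := by
      rw [tauQ]
      field_simp
    rw [htau, zero_mul, smul_eq_mul] at hsub
    rw [← hsub]
    refine intervalIntegral.integral_congr_Ioo_of_le ?_ ?_
    · rw [tauQ]; positivity
    intro lam hlam
    have h1 : 0 < lam * Real.log Q := mul_pos hlam.1 hlog
    have h2 : lam * Real.log Q < Real.pi := by
      rw [← htau]
      exact mul_lt_mul_of_pos_right hlam.2 hlog
    have hne : (Q : ℂ) ^ (I * (lam : ℂ)) ≠ (Q : ℂ) ^ (-(I * (lam : ℂ))) := by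
      rw [hpow, hpow']
      intro h
      have h3 := congrArg Complex.im h
      rw [← mul_neg, mul_comm I, mul_comm I] at h3
      rw [← Complex.ofReal_mul, ← Complex.ofReal_neg, Complex.exp_ofReal_mul_I_im,
        Complex.exp_ofReal_mul_I_im, Real.sin_neg] at h3
      linarith [Real.sin_pos_of_pos_of_lt_pi h1 h2]
    have hK : 1 / ((s : ℂ) + (s : ℂ)⁻¹) ≠ 0 := by
      have : 0 < s := by linarith
      exact_mod_cast (by positivity : 1 / (s + s⁻¹) ≠ 0)
    have key := normSq_add_div_normSq_eq p hs1 (z := (Q : ℂ) ^ (I * (lam : ℂ)))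
      (w := (Q : ℂ) ^ (-(I * (lam : ℂ)))) (by
        rw [hpow, hpow', ← Complex.exp_conj]
        simp only [map_mul, Complex.conj_I, Complex.conj_ofReal, neg_mul]) (by rw [hpow, hpow', ← Complex.exp_add]; simp) hne hK
    dsimp only
    rw [sphTransform_eq hQ hN' hne, cFun_eq hQ, cFun_eq hQ, mul_neg, neg_neg, key, hsq]
    simp only [hg, hpow, hpow']
    push_cast
    rfl
  have hcoeff0 : p.coeff 0 = f 0 := by simp [hp, coeff_sphPoly, sphCoeff]
  have hnorm : ∀ n, ‖sphCoeff Q f (n + 1)‖ ^ 2 =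
      ((Q : ℝ) + 1) / Q * (((Q : ℝ) + 1) * (Q : ℝ) ^ n * ‖f (n + 1)‖ ^ 2) := by
    intro n
    have h1 : ‖(Q : ℂ) + 1‖ = (Q : ℝ) + 1 := by exact_mod_cast Complex.norm_natCast (Q + 1)
    simp only [sphCoeff, norm_mul, norm_pow, norm_inv, Complex.norm_natCast, Complex.norm_real, h1]
    rw [← hs, Real.norm_of_nonneg (by linarith), mul_pow, ← pow_mul, mul_comm (n + 1) 2, pow_mul,
      inv_pow, hsq, inv_pow]
    field_simp
    ring
  have hsum : ∑ i ∈ p.support, ‖p.coeff i‖ ^ 2 =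
      ‖f 0‖ ^ 2 + ((Q : ℝ) + 1) / Q *
        ∑' n : ℕ, ((Q : ℝ) + 1) * (Q : ℝ) ^ n * ‖f (n + 1)‖ ^ 2 := by
    rw [tsum_eq_sum (s := Finset.range N), Finset.mul_sum,
      Finset.sum_subset (s₂ := Finset.range (N + 1)), Finset.sum_range_succ', hcoeff0, add_comm]
    · congr 1
      refine Finset.sum_congr rfl fun n hn => ?_
      rw [hp, coeff_sphPoly, if_pos (by simpa using hn), hnorm]
    · intro n hn
      by_contra h
      rw [Polynomial.mem_support_iff, hp, coeff_sphPoly, if_neg (by simpa using h)] at hn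
      exact hn rfl
    · intro n _ hn
      simp [Polynomial.notMem_support_iff.mp hn]
    · intro n hn
      rw [hN' (n + 1) (by simpa using hn)]
      simp
  rw [hint, hgavg, hsum, hcoeff0, tauQ]
  have hconst : s / (s + s⁻¹) = (Q : ℝ) / (Q + 1) := by
    rw [← hsq]
    have : 0 < s := by linarith
    field_simp
  rw [hconst]
  field_simp
  ring
end
end

section
/- For all exponents $2<q,r<\infty$ with $\frac{q}{2}<r<q$, there exists a constant $C>0$ such that for all $f_1\in L^{q'}(\mathbb{T})$ (where $\frac1q+\frac1{q'}=1$) and all radial $f_2\in L^r(\mathbb{T})$ one has $\|f_1*f_2\|_{L^q(\mathbb{T})}\le C\,\|f_1\|_{L^{q'}(\mathbb{T})}\,\|f_2\|_{L^r(\mathbb{T})}$. -/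
noncomputable section

open Complex MeasureTheory Filter
open scoped ENNReal NNReal Topology

/-- A homogeneous tree of degree `Q+1`: a connected acyclic graph in which every
vertex has exactly `Q+1` neighbours. -/
structure HomTree (Q : ℕ) : Type 1 where
  V : Type
  graph : SimpleGraph V
  isTree : graph.IsTree
  regular : ∀ x : V, {y : V | graph.Adj x y}.ncard = Q + 1

/-- The sum of `g` over the sphere of radius `n` centred at `x`. -/
def sphereSum {Q : ℕ} (T : HomTree Q) (g : T.V → ℂ) (x : T.V) (n : ℕ) : ℂ :=
  ∑' y : {y : T.V // T.graph.dist x y = n}, g y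

/-- Convolution of `f₁ : 𝕋 → ℂ` with a radial function `f₂ : ℕ → ℂ`:
`f₁ * f₂ (x) = ∑_{n≥0} f₂(n) ∑_{d(x,y)=n} f₁(y)`. -/
def radConv {Q : ℕ} (T : HomTree Q) (f1 : T.V → ℂ) (f2 : ℕ → ℂ) (x : T.V) : ℂ :=
  ∑' n : ℕ, f2 n * sphereSum T f1 x n

/-- The `ℓ^r(𝕋)` norm (valued in `ℝ≥0∞`), `(∑_x |g x|^r)^{1/r}`. -/
def spaceNormR {Q : ℕ} (T : HomTree Q) (r : ℝ) (g : T.V → ℂ) : ℝ≥0∞ :=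
  (∑' x : T.V, (‖g x‖₊ : ℝ≥0∞) ^ r) ^ (1 / r)

/-- The `L^r` norm of a radial function on the tree (valued in `ℝ≥0∞`):
`(|f₂(0)|^r + ∑_{n≥1} (Q+1) Q^{n-1} |f₂(n)|^r)^{1/r}`. -/
def radNorm (Q : ℕ) (r : ℝ) (f2 : ℕ → ℂ) : ℝ≥0∞ :=
  ((‖f2 0‖₊ : ℝ≥0∞) ^ r +
    ∑' n : ℕ, ((Q : ℝ≥0∞) + 1) * (Q : ℝ≥0∞) ^ n * (‖f2 (n + 1)‖₊ : ℝ≥0∞) ^ r) ^ (1 / r)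


section GraphSpheres

variable {V : Type*} {G : SimpleGraph V}

/-- The sum of `g` over the sphere of radius `n` centred at `x`, for `ℝ≥0∞`-valued `g`. -/
def esphereSum (G : SimpleGraph V) (n : ℕ) (g : V → ℝ≥0∞) (x : V) : ℝ≥0∞ :=
  ∑' y, if G.dist x y = n then g y else 0

theorem exists_adj_dist_eq_dist_add_one (hG : G.IsTree) {x y : V} (hxy : x ≠ y) :
    ∃ w, G.Adj x w ∧ G.dist x y = G.dist w y + 1 ∧
      ∀ v, G.Adj x v → v ≠ w → G.dist v y = G.dist x y + 1 := by
  obtain ⟨p, hp⟩ := hG.connected.exists_walk_length_eq_dist x y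
  cases p with
  | nil => exact absurd rfl hxy
  | @cons _ w _ h p =>
    have hpath := (SimpleGraph.Walk.cons h p).isPath_of_length_eq_dist hp
    have hw : G.dist x y = G.dist w y + 1 := by
      have h1 := G.dist_le p
      have h2 := hG.dist_eq_dist_add_one_of_adj y h
      rw [G.dist_comm (u := y), G.dist_comm (u := y)] at h2
      simp only [SimpleGraph.Walk.length_cons] at hp
      omega
    refine ⟨w, h, hw, fun v hv hvw => ?_⟩
    have h2 := hG.dist_eq_dist_add_one_of_adj y hv
    rw [G.dist_comm (u := y), G.dist_comm (u := y)] at h2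
    refine h2.resolve_left fun h3 => hvw ?_
    obtain ⟨r, hr⟩ := hG.connected.exists_walk_length_eq_dist v y
    have hpath' := (SimpleGraph.Walk.cons hv r).isPath_of_length_eq_dist (by
      simp only [SimpleGraph.Walk.length_cons]; omega)
    have := congrArg (fun p : G.Path x y => p.1.snd)
      ((hG.isAcyclic.subsingleton_path x y).elim ⟨_, hpath'⟩ ⟨_, hpath⟩)
    simpa using this

open Classical in
theorem tsum_adj_dist {Q : ℕ} (hG : G.IsTree)
    (hreg : ∀ x : V, {y : V | G.Adj x y}.ncard = Q + 1) (x y : V) (g : ℕ → ℝ≥0∞) :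
    ∑' w, (if G.Adj x w then g (G.dist w y) else 0) =
      if x = y then ((Q : ℝ≥0∞) + 1) * g 1
      else g (G.dist x y - 1) + (Q : ℝ≥0∞) * g (G.dist x y + 1) := by
  have hfin : {w : V | G.Adj x w}.Finite :=
    Set.finite_of_ncard_ne_zero (by rw [hreg]; omega)
  have hcard : hfin.toFinset.card = Q + 1 := by
    rw [← Set.ncard_eq_toFinset_card _ hfin, hreg]
  rw [tsum_eq_sum (s := hfin.toFinset) (fun w hw => by
    rw [Set.Finite.mem_toFinset, Set.mem_ofPred_eq] at hw; exact if_neg hw)]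
  split_ifs with hxy
  · subst hxy
    rw [Finset.sum_congr rfl (g := fun _ => g 1) fun w hw => by
      rw [Set.Finite.mem_toFinset, Set.mem_ofPred_eq] at hw
      rw [if_pos hw, G.dist_comm, SimpleGraph.dist_eq_one_iff_adj.2 hw]]
    simp [hcard]
  · obtain ⟨w, hw, hd, huniq⟩ := exists_adj_dist_eq_dist_add_one hG hxy
    have hmem : w ∈ hfin.toFinset := by rw [Set.Finite.mem_toFinset]; exact hw
    rw [← Finset.add_sum_erase _ _ hmem, if_pos hw,
      Finset.sum_congr rfl (g := fun _ => g (G.dist x y + 1)) fun v hv => by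
        rw [Finset.mem_erase, Set.Finite.mem_toFinset, Set.mem_ofPred_eq] at hv
        rw [if_pos hv.2, huniq v hv.2 hv.1]]
    simp [Finset.card_erase_of_mem hmem, hcard, hd]

theorem esphereSum_zero (hG : G.IsTree) (g : V → ℝ≥0∞) (x : V) : esphereSum G 0 g x = g x := by
  rw [esphereSum, tsum_eq_single x (fun y hy =>
    if_neg fun h => hy (hG.connected.dist_eq_zero_iff.1 h).symm), if_pos SimpleGraph.dist_self]

open Classical in
theorem esphereSum_one (g : V → ℝ≥0∞) (x : V) :
    esphereSum G 1 g x = ∑' y, if G.Adj x y then g y else 0 := by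
  simp only [esphereSum, SimpleGraph.dist_eq_one_iff_adj]

theorem esphereSum_mul_left (n : ℕ) (c : ℝ≥0∞) (g : V → ℝ≥0∞) (x : V) :
    esphereSum G n (fun y => c * g y) x = c * esphereSum G n g x := by
  simp only [esphereSum, ← ENNReal.tsum_mul_left, mul_ite, mul_zero]

theorem esphereSum_le_tsum (n : ℕ) (g : V → ℝ≥0∞) (x : V) : esphereSum G n g x ≤ ∑' y, g y :=
  ENNReal.tsum_le_tsum fun y => by split_ifs <;> simp

/-- Sphere sums are symmetric for the bilinear pairing. -/
theorem tsum_mul_esphereSum (n : ℕ) (f g : V → ℝ≥0∞) :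
    ∑' x, f x * esphereSum G n g x = ∑' y, esphereSum G n f y * g y := by
  simp only [esphereSum, ← ENNReal.tsum_mul_left, ← ENNReal.tsum_mul_right]
  rw [ENNReal.tsum_comm]
  refine tsum_congr fun y => tsum_congr fun x => ?_
  rw [G.dist_comm]
  split_ifs <;> simp

theorem esphereSum_one_esphereSum_succ {Q : ℕ} (hG : G.IsTree)
    (hreg : ∀ x : V, {y : V | G.Adj x y}.ncard = Q + 1) (n : ℕ) (g : V → ℝ≥0∞) (x : V) :
    esphereSum G 1 (esphereSum G (n + 1) g) x =
      esphereSum G (n + 2) g x +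
        (if n = 0 then (Q : ℝ≥0∞) + 1 else (Q : ℝ≥0∞)) * esphereSum G n g x := by
  classical
  have h : esphereSum G 1 (esphereSum G (n + 1) g) x =
      ∑' y, (∑' w, if G.Adj x w then (if G.dist w y = n + 1 then (1 : ℝ≥0∞) else 0) else 0) *
        g y := by
    rw [esphereSum_one]
    simp only [← ENNReal.tsum_mul_right]
    rw [ENNReal.tsum_comm]
    refine tsum_congr fun w => ?_
    split_ifs
    · simp only [esphereSum, ite_mul, one_mul, zero_mul]
    · simp
  rw [h]
  simp only [esphereSum, ← ENNReal.tsum_mul_left, ← ENNReal.tsum_add]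
  refine tsum_congr fun y => ?_
  rw [tsum_adj_dist hG hreg x y fun k => if k = n + 1 then 1 else 0]
  by_cases hxy : x = y
  · subst hxy
    by_cases hn : n = 0
    · simp [hn]
    · simp [hn, Ne.symm hn]
  · have hpos : 0 < G.dist x y := hG.connected.pos_dist_of_ne hxy
    rw [if_neg hxy]
    by_cases h1 : G.dist x y = n + 2
    · simp [h1]
    · by_cases h2 : G.dist x y = n
      · have hn : n ≠ 0 := by omega
        have : ¬ (n - 1 = n + 1) := by omega
        simp [h2, hn, this]
      · have : ¬ (G.dist x y - 1 = n + 1) := by omega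
        simp [h1, h2, this]

/-- Hölder's inequality for sums in `ℝ≥0∞`. -/
theorem tsum_rpow_mul_rpow_le {ι : Type*} (f g : ι → ℝ≥0∞) {p q : ℝ} (hp : 0 ≤ p) (hq : 0 ≤ q)
    (hpq : p + q = 1) :
    ∑' i, f i ^ p * g i ^ q ≤ (∑' i, f i) ^ p * (∑' i, g i) ^ q := by
  let _ : MeasurableSpace ι := ⊤
  have := ENNReal.lintegral_mul_norm_pow_le (μ := Measure.count) (f := f) (g := g)
    measurable_from_top.aemeasurable measurable_from_top.aemeasurable hp hq hpq
  simpa only [lintegral_count] using this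

theorem esphereSum_rpow_mul_rpow_le (n : ℕ) (f g : V → ℝ≥0∞) {p q : ℝ} (hp : 0 < p) (hq : 0 < q)
    (hpq : p + q = 1) (x : V) :
    esphereSum G n (fun y => f y ^ p * g y ^ q) x ≤
      esphereSum G n f x ^ p * esphereSum G n g x ^ q := by
  refine le_trans (le_of_eq ?_) (tsum_rpow_mul_rpow_le _ _ hp.le hq.le hpq)
  refine tsum_congr fun y => ?_
  split_ifs <;> simp [hp, hq]

/-- Schur's test for sphere sums. -/
theorem tsum_esphereSum_sq_le (n : ℕ) (φ : V → ℝ≥0∞) (hφ0 : ∀ x, φ x ≠ 0) (hφ : ∀ x, φ x ≠ ⊤)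
    (L : ℝ≥0∞) (hL : ∀ x, esphereSum G n φ x ≤ L * φ x) (f : V → ℝ≥0∞) :
    ∑' x, esphereSum G n f x ^ (2 : ℝ) ≤ L ^ (2 : ℝ) * ∑' x, f x ^ (2 : ℝ) := by
  have key : ∀ x, esphereSum G n f x ^ (2 : ℝ) ≤
      L * (φ x * esphereSum G n (fun y => f y ^ (2 : ℝ) * (φ y)⁻¹) x) := fun x => by
    have hf : f = fun y => φ y ^ (1 / 2 : ℝ) * (f y ^ (2 : ℝ) * (φ y)⁻¹) ^ (1 / 2 : ℝ) := by
      funext y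
      rw [← ENNReal.mul_rpow_of_nonneg _ _ (by norm_num), mul_comm, mul_assoc,
        ENNReal.inv_mul_cancel (hφ0 y) (hφ y), mul_one, ← ENNReal.rpow_mul]
      norm_num
    have h := esphereSum_rpow_mul_rpow_le (G := G) n φ (fun y => f y ^ (2 : ℝ) * (φ y)⁻¹)
      (p := 1 / 2) (q := 1 / 2) (by norm_num) (by norm_num) (by norm_num) x
    rw [← hf, ← ENNReal.mul_rpow_of_nonneg _ _ (by norm_num)] at h
    calc esphereSum G n f x ^ (2 : ℝ) ≤ _ := ENNReal.rpow_le_rpow h (by norm_num)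
      _ = esphereSum G n φ x * esphereSum G n (fun y => f y ^ (2 : ℝ) * (φ y)⁻¹) x := by
        rw [← ENNReal.rpow_mul]; norm_num
      _ ≤ _ := by rw [← mul_assoc]; gcongr; exact hL x
  calc ∑' x, esphereSum G n f x ^ (2 : ℝ)
      ≤ ∑' x, L * (φ x * esphereSum G n (fun y => f y ^ (2 : ℝ) * (φ y)⁻¹) x) :=
        ENNReal.tsum_le_tsum key
    _ = L * ∑' y, esphereSum G n φ y * (f y ^ (2 : ℝ) * (φ y)⁻¹) := by
        rw [ENNReal.tsum_mul_left, tsum_mul_esphereSum]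
    _ ≤ L * ∑' y, L * f y ^ (2 : ℝ) := by
        refine mul_le_mul_right (ENNReal.tsum_le_tsum fun y => ?_) L
        calc _ ≤ L * φ y * (f y ^ (2 : ℝ) * (φ y)⁻¹) := by gcongr; exact hL y
          _ = L * f y ^ (2 : ℝ) * (φ y * (φ y)⁻¹) := by ring
          _ = _ := by rw [ENNReal.mul_inv_cancel (hφ0 y) (hφ y), mul_one]
    _ = _ := by
        rw [ENNReal.tsum_mul_left, ← mul_assoc, ← sq, ENNReal.rpow_two]

/-- Interpolation between the `ℓ²` bound and the trivial `ℓ¹ → ℓ^∞` bound for sphere sums. -/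
theorem tsum_esphereSum_rpow_le (n : ℕ) (L : ℝ≥0∞)
    (hL : ∀ f : V → ℝ≥0∞,
      ∑' x, esphereSum G n f x ^ (2 : ℝ) ≤ L ^ (2 : ℝ) * ∑' x, f x ^ (2 : ℝ))
    {q : ℝ} (hq : 2 < q) (f : V → ℝ≥0∞) :
    ∑' x, esphereSum G n f x ^ q ≤
      L ^ (2 : ℝ) * (∑' x, f x ^ (q / (q - 1))) ^ (q - 1) := by
  have hq0 : q ≠ 0 := by linarith
  have hq1 : q - 1 ≠ 0 := by linarith
  set F : V → ℝ≥0∞ := fun y => f y ^ (q / (q - 1)) with hF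
  have hθ : 0 < 2 / q := by positivity
  have hθ' : 0 < 1 - 2 / q := by
    rw [sub_pos, div_lt_one (by linarith)]; exact hq
  have hf : f = fun y => F y ^ (1 - 2 / q) * (F y ^ (1 / 2 : ℝ)) ^ (2 / q) := by
    funext y
    rw [← ENNReal.rpow_mul (F y), ← ENNReal.rpow_add_of_nonneg _ _ hθ'.le (by positivity), hF,
      ← ENNReal.rpow_mul]
    have : q / (q - 1) * (1 - 2 / q + 1 / 2 * (2 / q)) = 1 := by field_simp; ring
    rw [this, ENNReal.rpow_one]
  have key : ∀ x, esphereSum G n f x ^ q ≤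
      (∑' y, F y) ^ (q - 2) * esphereSum G n (fun y => F y ^ (1 / 2 : ℝ)) x ^ (2 : ℝ) := fun x => by
    have h := esphereSum_rpow_mul_rpow_le (G := G) n F (fun y => F y ^ (1 / 2 : ℝ)) hθ' hθ
      (by ring) x
    rw [← hf] at h
    calc esphereSum G n f x ^ q ≤ _ := ENNReal.rpow_le_rpow h (by linarith)
      _ = esphereSum G n F x ^ (q - 2) *
          esphereSum G n (fun y => F y ^ (1 / 2 : ℝ)) x ^ (2 : ℝ) := by
        rw [ENNReal.mul_rpow_of_nonneg _ _ (by linarith), ← ENNReal.rpow_mul, ← ENNReal.rpow_mul]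
        congr 2 <;> field_simp
      _ ≤ _ := by
        gcongr
        exact esphereSum_le_tsum n F x
  calc ∑' x, esphereSum G n f x ^ q ≤ _ := ENNReal.tsum_le_tsum key
    _ ≤ (∑' y, F y) ^ (q - 2) * (L ^ (2 : ℝ) * ∑' x, (F x ^ (1 / 2 : ℝ)) ^ (2 : ℝ)) := by
        rw [ENNReal.tsum_mul_left]; gcongr; exact hL _
    _ = (∑' y, F y) ^ (q - 2) * (L ^ (2 : ℝ) * ∑' x, F x) := by
        simp only [← ENNReal.rpow_mul]; norm_num
    _ = L ^ (2 : ℝ) * ((∑' y, F y) ^ (q - 2) * (∑' x, F x) ^ (1 : ℝ)) := by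
        rw [ENNReal.rpow_one]; ring
    _ = _ := by
        rw [← ENNReal.rpow_add_of_nonneg _ _ (by linarith) (by norm_num)]
        congr 2; ring

end GraphSpheres

/-- A form of Minkowski's inequality for infinite sums. -/
theorem tsum_tsum_rpow_le {ι κ : Type*} (u : ι → κ → ℝ≥0∞) (w : ι → ℝ≥0∞) (hw0 : ∀ i, w i ≠ 0)
    (hw : ∀ i, w i ≠ ⊤) (M : ℝ≥0∞) {q : ℝ} (hq : 1 < q)
    (h : ∀ i, ∑' x, u i x ^ q ≤ (M * w i) ^ q) :
    ∑' x, (∑' i, u i x) ^ q ≤ (M * ∑' i, w i) ^ q := by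
  have hq0 : 0 < q := by linarith
  have hθ : 0 < 1 / q := by positivity
  have hθ' : 0 < 1 - 1 / q := by
    rw [sub_pos, div_lt_one hq0]; exact hq
  have key : ∀ x, (∑' i, u i x) ^ q ≤ (∑' i, w i) ^ (q - 1) * ∑' i, w i ^ (1 - q) * u i x ^ q :=
    fun x => by
    have h := tsum_rpow_mul_rpow_le w (fun i => w i ^ (1 - q) * u i x ^ q) hθ'.le hθ.le (by ring)
    have e : ∀ i, w i ^ (1 - 1 / q) * (w i ^ (1 - q) * u i x ^ q) ^ (1 / q) = u i x := fun i => by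
      rw [ENNReal.mul_rpow_of_nonneg _ _ hθ.le, ← ENNReal.rpow_mul, ← ENNReal.rpow_mul, ← mul_assoc,
        ← ENNReal.rpow_add _ _ (hw0 i) (hw i)]
      have h1 : 1 - 1 / q + (1 - q) * (1 / q) = 0 := by field_simp; ring
      have h2 : q * (1 / q) = 1 := by field_simp
      rw [h1, h2]; simp
    simp only [e] at h
    refine (ENNReal.rpow_le_rpow h hq0.le).trans (le_of_eq ?_)
    rw [ENNReal.mul_rpow_of_nonneg _ _ hq0.le, ← ENNReal.rpow_mul, ← ENNReal.rpow_mul]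
    have h1 : (1 - 1 / q) * q = q - 1 := by field_simp
    have h2 : 1 / q * q = 1 := by field_simp
    rw [h1, h2, ENNReal.rpow_one]
  calc ∑' x, (∑' i, u i x) ^ q ≤ _ := ENNReal.tsum_le_tsum key
    _ = (∑' i, w i) ^ (q - 1) * ∑' i, w i ^ (1 - q) * ∑' x, u i x ^ q := by
        rw [ENNReal.tsum_mul_left, ENNReal.tsum_comm]
        simp only [ENNReal.tsum_mul_left]
    _ ≤ (∑' i, w i) ^ (q - 1) * ∑' i, M ^ q * w i := by
        refine mul_le_mul_right (ENNReal.tsum_le_tsum fun i => ?_) _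
        calc _ ≤ w i ^ (1 - q) * (M * w i) ^ q := by gcongr; exact h i
          _ = M ^ q * (w i ^ (1 - q) * w i ^ q) := by
            rw [ENNReal.mul_rpow_of_nonneg _ _ hq0.le]; ring
          _ = M ^ q * w i := by
            rw [← ENNReal.rpow_add _ _ (hw0 i) (hw i)]; simp
    _ = M ^ q * ((∑' i, w i) ^ (q - 1) * (∑' i, w i) ^ (1 : ℝ)) := by
        rw [ENNReal.tsum_mul_left, ENNReal.rpow_one]; ring
    _ = _ := by
        rw [← ENNReal.rpow_add_of_nonneg _ _ (by linarith) (by norm_num),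
          ENNReal.mul_rpow_of_nonneg _ _ hq0.le]
        simp

/-- The value at distance `k` from the base point of the ground spherical function of the
homogeneous tree of degree `Q + 1`. -/
def groundSpherical (Q k : ℕ) : ℝ := (1 + (Q - 1) / (Q + 1) * k) * (√Q)⁻¹ ^ k

/-- The eigenvalue of the sphere sum of radius `n` on the ground spherical function. -/
def sphereEigenvalue (Q : ℕ) : ℕ → ℝ
  | 0 => 1
  | n + 1 => (1 + 1 / Q + (n + 1) * (1 - 1 / Q)) * √Q ^ (n + 1)

section Spherical

variable {Q : ℕ}

theorem groundSpherical_pos (hQ : 1 ≤ Q) (k : ℕ) : 0 < groundSpherical Q k := by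
  have h : (1 : ℝ) ≤ Q := by exact_mod_cast hQ
  have : 0 ≤ ((Q : ℝ) - 1) / (Q + 1) * k :=
    mul_nonneg (div_nonneg (by linarith) (by linarith)) (Nat.cast_nonneg k)
  unfold groundSpherical
  positivity

theorem groundSpherical_one (hQ : 1 ≤ Q) :
    (Q + 1) * groundSpherical Q 1 = 2 * √Q * groundSpherical Q 0 := by
  have h : (0 : ℝ) < Q := by exact_mod_cast hQ
  have hs : 0 < √(Q : ℝ) := Real.sqrt_pos.2 h
  have hs2 : √(Q : ℝ) ^ 2 = Q := Real.sq_sqrt h.le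
  have h1 : (Q : ℝ) + 1 ≠ 0 := by positivity
  simp only [groundSpherical]
  push_cast
  generalize √(Q : ℝ) = s at *
  rw [← hs2] at h1 ⊢
  field_simp
  ring

theorem groundSpherical_recurrence (hQ : 1 ≤ Q) (k : ℕ) :
    groundSpherical Q k + Q * groundSpherical Q (k + 2) =
      2 * √Q * groundSpherical Q (k + 1) := by
  have h : (0 : ℝ) < Q := by exact_mod_cast hQ
  have hs : 0 < √(Q : ℝ) := Real.sqrt_pos.2 h
  have hs2 : √(Q : ℝ) ^ 2 = Q := Real.sq_sqrt h.le
  have h1 : (Q : ℝ) + 1 ≠ 0 := by positivity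
  simp only [groundSpherical, pow_succ]
  push_cast
  generalize √(Q : ℝ) = s at *
  rw [← hs2] at h1 ⊢
  field_simp
  ring

theorem sphereEigenvalue_nonneg (hQ : 1 ≤ Q) (n : ℕ) : 0 ≤ sphereEigenvalue Q n := by
  have h : (1 : ℝ) ≤ Q := by exact_mod_cast hQ
  cases n with
  | zero => simp [sphereEigenvalue]
  | succ n =>
    have : (1 : ℝ) / Q ≤ 1 := by rw [div_le_one (by linarith)]; exact h
    have : 0 ≤ ((n : ℝ) + 1) * (1 - 1 / Q) := mul_nonneg (by positivity) (by linarith)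
    simp only [sphereEigenvalue]
    positivity

theorem sphereEigenvalue_one : sphereEigenvalue Q 1 = 2 * √Q := by
  simp only [sphereEigenvalue]
  push_cast
  ring

theorem sphereEigenvalue_recurrence (hQ : 1 ≤ Q) (n : ℕ) :
    sphereEigenvalue Q (n + 2) + (if n = 0 then (Q : ℝ) + 1 else Q) * sphereEigenvalue Q n =
      2 * √Q * sphereEigenvalue Q (n + 1) := by
  have h : (0 : ℝ) < Q := by exact_mod_cast hQ
  have hs : 0 < √(Q : ℝ) := Real.sqrt_pos.2 h
  have hs2 : √(Q : ℝ) ^ 2 = Q := Real.sq_sqrt h.le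
  cases n with
  | zero =>
    simp only [sphereEigenvalue, if_true]
    push_cast
    generalize √(Q : ℝ) = s at *
    rw [← hs2]
    field_simp
    ring
  | succ n =>
    simp only [sphereEigenvalue, Nat.succ_ne_zero, if_false, pow_succ]
    push_cast
    generalize √(Q : ℝ) = s at *
    rw [← hs2]
    field_simp
    ring

theorem sphereEigenvalue_le (hQ : 1 ≤ Q) (n : ℕ) :
    sphereEigenvalue Q n ≤ 2 * (n + 1) * √Q ^ n := by
  have h : (1 : ℝ) ≤ Q := by exact_mod_cast hQ
  cases n with
  | zero => norm_num [sphereEigenvalue]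
  | succ n =>
    have h1 : (1 : ℝ) / Q ≤ 1 := by rw [div_le_one (by linarith)]; exact h
    have h2 : (0 : ℝ) ≤ 1 / Q := by positivity
    have hn : (0 : ℝ) ≤ n := Nat.cast_nonneg n
    simp only [sphereEigenvalue]
    push_cast
    gcongr
    nlinarith [mul_nonneg hn h2]

variable {V : Type*} {G : SimpleGraph V}

theorem esphereSum_one_groundSpherical (hQ : 1 ≤ Q) (hG : G.IsTree)
    (hreg : ∀ x : V, {y : V | G.Adj x y}.ncard = Q + 1) (o x : V) :
    esphereSum G 1 (fun y => ENNReal.ofReal (groundSpherical Q (G.dist y o))) x =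
      ENNReal.ofReal (2 * √Q) * ENNReal.ofReal (groundSpherical Q (G.dist x o)) := by
  have hp := fun k => (groundSpherical_pos hQ k).le
  rw [esphereSum_one, tsum_adj_dist hG hreg x o fun k => ENNReal.ofReal (groundSpherical Q k),
    ← ENNReal.ofReal_mul (by positivity)]
  split_ifs with hx
  · subst hx
    rw [SimpleGraph.dist_self, ← groundSpherical_one hQ, ENNReal.ofReal_mul (by positivity),
      ENNReal.ofReal_add (by positivity) (by norm_num)]
    simp
  · obtain ⟨k, hk⟩ := Nat.exists_eq_succ_of_ne_zero (hG.connected.pos_dist_of_ne hx).ne'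
    rw [hk, Nat.succ_eq_add_one, ← groundSpherical_recurrence hQ, ENNReal.ofReal_add (hp _)
      (mul_nonneg (by positivity) (hp _)), ENNReal.ofReal_mul (by positivity)]
    simp

theorem esphereSum_groundSpherical (hQ : 1 ≤ Q) (hG : G.IsTree)
    (hreg : ∀ x : V, {y : V | G.Adj x y}.ncard = Q + 1) (o : V) (n : ℕ) (x : V) :
    esphereSum G n (fun y => ENNReal.ofReal (groundSpherical Q (G.dist y o))) x =
      ENNReal.ofReal (sphereEigenvalue Q n) *
        ENNReal.ofReal (groundSpherical Q (G.dist x o)) := by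
  have h1 := esphereSum_one_groundSpherical hQ hG hreg o
  have hl := sphereEigenvalue_nonneg hQ
  induction n using Nat.twoStepInduction generalizing x with
  | zero => rw [esphereSum_zero hG]; simp [sphereEigenvalue]
  | one => rw [h1, sphereEigenvalue_one]
  | more n ih0 ih1 =>
    have key := esphereSum_one_esphereSum_succ hG hreg n
      (fun y => ENNReal.ofReal (groundSpherical Q (G.dist y o))) x
    rw [funext ih1, esphereSum_mul_left, h1, ih0] at key
    have hc : (if n = 0 then (Q : ℝ≥0∞) + 1 else (Q : ℝ≥0∞)) =
        ENNReal.ofReal (if n = 0 then (Q : ℝ) + 1 else Q) := by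
      split_ifs
      · rw [ENNReal.ofReal_add (by positivity) (by norm_num)]; simp
      · simp
    have hc0 : 0 ≤ if n = 0 then (Q : ℝ) + 1 else Q := by split_ifs <;> positivity
    rw [hc, ← mul_assoc, ← mul_assoc, ← ENNReal.ofReal_mul (hl _), ← ENNReal.ofReal_mul hc0,
      mul_comm (sphereEigenvalue Q (n + 1)), ← sphereEigenvalue_recurrence hQ,
      ENNReal.ofReal_add (hl _) (mul_nonneg hc0 (hl _)), add_mul] at key
    exact ((ENNReal.add_left_inj
      (ENNReal.mul_ne_top ENNReal.ofReal_ne_top ENNReal.ofReal_ne_top)).1 key).symm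

/-- The `ℓ² → ℓ²` bound for sphere sums on the homogeneous tree. -/
theorem tsum_esphereSum_sq_le_of_isTree (hQ : 1 ≤ Q) (hG : G.IsTree)
    (hreg : ∀ x : V, {y : V | G.Adj x y}.ncard = Q + 1) (n : ℕ) (f : V → ℝ≥0∞) :
    ∑' x, esphereSum G n f x ^ (2 : ℝ) ≤
      ENNReal.ofReal (sphereEigenvalue Q n) ^ (2 : ℝ) * ∑' x, f x ^ (2 : ℝ) := by
  obtain ⟨o⟩ := hG.connected.nonempty
  exact tsum_esphereSum_sq_le n
    (fun y => ENNReal.ofReal (groundSpherical Q (G.dist y o)))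
    (fun x => (ENNReal.ofReal_pos.2 (groundSpherical_pos hQ _)).ne')
    (fun x => ENNReal.ofReal_ne_top) _
    (fun x => (esphereSum_groundSpherical hQ hG hreg o n x).le) f

end Spherical

theorem enorm_radConv_le {Q : ℕ} (T : HomTree Q) (f1 : T.V → ℂ) (f2 : ℕ → ℂ) (x : T.V) :
    ‖radConv T f1 f2 x‖ₑ ≤ ∑' n, ‖f2 n‖ₑ * esphereSum T.graph n (fun y => ‖f1 y‖ₑ) x := by
  refine enorm_tsum_le_tsum_enorm.trans (ENNReal.tsum_le_tsum fun n => ?_)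
  rw [enorm_mul]
  gcongr
  refine enorm_tsum_le_tsum_enorm.trans (le_of_eq ?_)
  refine (tsum_subtype {y | T.graph.dist x y = n} (fun y => ‖f1 y‖ₑ)).trans ?_
  refine tsum_congr fun y => ?_
  simp [Set.indicator_apply]

theorem enorm_mul_le_radNorm {Q : ℕ} {r : ℝ} (hr : 0 < r) (f2 : ℕ → ℂ) (n : ℕ) :
    ‖f2 n‖ₑ * (Q : ℝ≥0∞) ^ (n / r) ≤ radNorm Q r f2 := by
  have h : (‖f2 n‖ₑ * (Q : ℝ≥0∞) ^ (n / r)) ^ r ≤ radNorm Q r f2 ^ r := by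
    rw [radNorm, ← ENNReal.rpow_mul, one_div_mul_cancel hr.ne', ENNReal.rpow_one,
      ENNReal.mul_rpow_of_nonneg _ _ hr.le, ← ENNReal.rpow_mul, div_mul_cancel₀ _ hr.ne',
      ENNReal.rpow_natCast]
    cases n with
    | zero => simp only [pow_zero, mul_one]; exact le_self_add
    | succ n =>
      refine le_add_left ?_
      refine le_trans ?_ (ENNReal.le_tsum n)
      rw [mul_comm, pow_succ']
      gcongr
      · exact le_self_add
      · exact le_rfl
  exact (ENNReal.rpow_le_rpow_iff hr).1 h

theorem summable_succ_mul_pow {ρ : ℝ} (h0 : 0 ≤ ρ) (h1 : ρ < 1) :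
    Summable fun n : ℕ => 2 * ((n : ℝ) + 1) * ρ ^ n := by
  have hn : ‖ρ‖ < 1 := by rwa [Real.norm_of_nonneg h0]
  have := ((summable_pow_mul_geometric_of_norm_lt_one 1 hn).add
    (summable_geometric_of_norm_lt_one hn)).mul_left 2
  refine this.congr fun n => ?_
  ring

theorem sphereEigenvalue_rpow_le {Q : ℕ} (hQ : 1 ≤ Q) {q r : ℝ} (hq : 2 < q) (n : ℕ) :
    ENNReal.ofReal (sphereEigenvalue Q n) ^ (2 / q) ≤
      (Q : ℝ≥0∞) ^ (n / r) *
        ENNReal.ofReal (2 * ((n : ℝ) + 1) * ((Q : ℝ) ^ (1 / q - 1 / r)) ^ n) := by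
  have hQ0 : (0 : ℝ) < Q := by exact_mod_cast hQ
  have hθ : 0 ≤ 2 / q := by positivity
  have hθ1 : 2 / q ≤ 1 := by rw [div_le_one (by linarith)]; exact hq.le
  rw [← ENNReal.ofReal_natCast Q, ENNReal.ofReal_rpow_of_pos hQ0,
    ← ENNReal.ofReal_mul (by positivity),
    ENNReal.ofReal_rpow_of_nonneg (sphereEigenvalue_nonneg hQ n) hθ]
  refine ENNReal.ofReal_le_ofReal ?_
  calc sphereEigenvalue Q n ^ (2 / q) ≤ (2 * ((n : ℝ) + 1) * √Q ^ n) ^ (2 / q) :=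
        Real.rpow_le_rpow (sphereEigenvalue_nonneg hQ n) (sphereEigenvalue_le hQ n) hθ
    _ = (2 * ((n : ℝ) + 1)) ^ (2 / q) * (Q : ℝ) ^ (n / q) := by
        rw [Real.mul_rpow (by positivity) (by positivity), Real.sqrt_eq_rpow, ← Real.rpow_natCast,
          ← Real.rpow_mul hQ0.le, ← Real.rpow_mul hQ0.le]
        congr 2
        ring
    _ ≤ (2 * ((n : ℝ) + 1)) ^ (1 : ℝ) * (Q : ℝ) ^ (n / q) := by
        gcongr
        have : (0 : ℝ) ≤ n := Nat.cast_nonneg n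
        linarith
    _ = _ := by
        rw [Real.rpow_one, mul_left_comm, ← Real.rpow_natCast, ← Real.rpow_mul hQ0.le,
          ← Real.rpow_add hQ0]
        congr 2
        ring

/-- Dual Kunze–Stein: for `2 < q, r < ∞` with `q/2 < r < q`,
`L^{q'}(𝕋) * L^r(𝕋)^♯ ⊆ L^q(𝕋)`, with
`‖f₁*f₂‖_{L^q} ≤ C ‖f₁‖_{L^{q'}} ‖f₂‖_{L^r}` where `1/q + 1/q' = 1`. -/
theorem dual_kunze_stein (Q : ℕ) (hQ : 2 ≤ Q) (T : HomTree Q) (q r : ℝ)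
    (hq : 2 < q) (hr : 2 < r) (hqr1 : q / 2 < r) (hqr2 : r < q) :
    ∃ C : ℝ≥0, 0 < C ∧ ∀ (f1 : T.V → ℂ) (f2 : ℕ → ℂ),
      spaceNormR T q (radConv T f1 f2) ≤
        (C : ℝ≥0∞) * spaceNormR T (q / (q - 1)) f1 * radNorm Q r f2 := by
  have hQ1 : 1 ≤ Q := by omega
  have hQ0 : (0 : ℝ) < Q := by exact_mod_cast hQ1
  have hq0 : 0 < q := by linarith
  have hr0 : 0 < r := by linarith
  set ρ : ℝ := (Q : ℝ) ^ (1 / q - 1 / r) with hρ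
  have hρ0 : 0 < ρ := Real.rpow_pos_of_pos hQ0 _
  have hρ1 : ρ < 1 := Real.rpow_lt_one_of_one_lt_of_neg (by exact_mod_cast hQ)
    (sub_neg.2 (one_div_lt_one_div_of_lt hr0 hqr2))
  set w : ℕ → ℝ≥0∞ := fun n => ENNReal.ofReal (2 * ((n : ℝ) + 1) * ρ ^ n) with hw
  have hw0 : ∀ n, w n ≠ 0 := fun n => (ENNReal.ofReal_pos.2 (by positivity)).ne'
  have hwtop : ∑' n, w n ≠ ⊤ := (summable_succ_mul_pow hρ0.le hρ1).tsum_ofReal_ne_top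
  have hwsum : ∑' n, w n ≠ 0 := fun h => hw0 0 (ENNReal.tsum_eq_zero.1 h 0)
  refine ⟨(∑' n, w n).toNNReal, ENNReal.toNNReal_pos hwsum hwtop, fun f1 f2 => ?_⟩
  rw [ENNReal.coe_toNNReal hwtop]
  have hN : spaceNormR T (q / (q - 1)) f1 ^ q =
      (∑' x, ‖f1 x‖ₑ ^ (q / (q - 1))) ^ (q - 1) := by
    have hq1 : q - 1 ≠ 0 := by linarith
    rw [spaceNormR, ← ENNReal.rpow_mul]
    congr 1
    field_simp
  have hterm : ∀ n, ∑' x, (‖f2 n‖ₑ * esphereSum T.graph n (fun y => ‖f1 y‖ₑ) x) ^ q ≤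
      (spaceNormR T (q / (q - 1)) f1 * radNorm Q r f2 * w n) ^ q := fun n => by
    set L := ENNReal.ofReal (sphereEigenvalue Q n)
    have hL : ‖f2 n‖ₑ * L ^ (2 / q) ≤ radNorm Q r f2 * w n :=
      calc ‖f2 n‖ₑ * L ^ (2 / q) ≤ ‖f2 n‖ₑ * ((Q : ℝ≥0∞) ^ (n / r) * w n) := by
            gcongr; exact sphereEigenvalue_rpow_le hQ1 hq n
        _ = ‖f2 n‖ₑ * (Q : ℝ≥0∞) ^ (n / r) * w n := (mul_assoc _ _ _).symm
        _ ≤ _ := by gcongr; exact enorm_mul_le_radNorm hr0 f2 n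
    calc ∑' x, (‖f2 n‖ₑ * esphereSum T.graph n (fun y => ‖f1 y‖ₑ) x) ^ q
        = ‖f2 n‖ₑ ^ q * ∑' x, esphereSum T.graph n (fun y => ‖f1 y‖ₑ) x ^ q := by
          simp only [ENNReal.mul_rpow_of_nonneg _ _ hq0.le, ENNReal.tsum_mul_left]
      _ ≤ ‖f2 n‖ₑ ^ q * (L ^ (2 : ℝ) * spaceNormR T (q / (q - 1)) f1 ^ q) := by
          rw [hN]
          gcongr
          exact tsum_esphereSum_rpow_le n L
            (tsum_esphereSum_sq_le_of_isTree hQ1 T.isTree T.regular n) hq _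
      _ = (‖f2 n‖ₑ * L ^ (2 / q) * spaceNormR T (q / (q - 1)) f1) ^ q := by
          rw [ENNReal.mul_rpow_of_nonneg _ _ hq0.le, ENNReal.mul_rpow_of_nonneg _ _ hq0.le,
            ← ENNReal.rpow_mul, div_mul_cancel₀ _ hq0.ne', mul_assoc]
      _ ≤ _ := by
          rw [mul_comm, mul_assoc (spaceNormR T _ f1)]
          gcongr
  have hmain := tsum_tsum_rpow_le _ w hw0 (fun _ => ENNReal.ofReal_ne_top) _
    (by linarith : 1 < q) hterm
  calc spaceNormR T q (radConv T f1 f2)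
      ≤ ((spaceNormR T (q / (q - 1)) f1 * radNorm Q r f2 * ∑' n, w n) ^ q) ^ (1 / q) := by
        refine ENNReal.rpow_le_rpow (le_trans ?_ hmain) (by positivity)
        exact ENNReal.tsum_le_tsum fun x => ENNReal.rpow_le_rpow (enorm_radConv_le T f1 f2 x) hq0.le
    _ = spaceNormR T (q / (q - 1)) f1 * radNorm Q r f2 * ∑' n, w n := by
        rw [← ENNReal.rpow_mul, mul_one_div_cancel hq0.ne', ENNReal.rpow_one]
    _ = _ := by ring
end
end
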